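/- Let f be the ECA of Wolfram rule 23, f(a,b,c) = ¬((a && b) || (b && c) || (a && c)) (the negation of the majority of the three cells). Then for every n ≥ 1, d_n(f) = n + 1. -/

import Mathlib

/-- The `n`-th iterate of a one-dimensional CA local rule `f`, applied to an
assignment `x` of states to integer positions. It only depends on positions `-n,…,n`:
`caIter f 1 x = f (x (-1)) (x 0) (x 1)` and
`caIter f (n+1) x = f (caIter f n (x shifted left)) (caIter f n x) (caIter f n (x shifted right))`. -/
def caIter {Q : Type*} (f : Q → Q → Q → Q) : ℕ → (ℤ → Q) → Q
  | 0, x => x 0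
  | n + 1, x =>
      f (caIter f n fun i => x (i - 1)) (caIter f n x) (caIter f n fun i => x (i + 1))

/-- The assignment of states to integer positions determined by left cells `u`
(`u i` at position `-(i+1)`), center `c` (position `0`) and right cells `v`
(`v i` at position `i+1`); positions outside `-n,…,n` (irrelevant for `caIter f n`)
are padded with `c`. -/
def caEmbed {Q : Type*} (n : ℕ) (u : Fin n → Q) (c : Q) (v : Fin n → Q) : ℤ → Q :=
  fun i =>
    if h : 1 ≤ i ∧ i ≤ (n : ℤ) then v ⟨(i - 1).toNat, by omega⟩
    else if h' : 1 ≤ -i ∧ -i ≤ (n : ℤ) then u ⟨(-i - 1).toNat, by omega⟩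
    else c

/-- `f^n(u, c, v)`. -/
def caApply {Q : Type*} (f : Q → Q → Q → Q) (n : ℕ) (u : Fin n → Q) (c : Q)
    (v : Fin n → Q) : Q :=
  caIter f n (caEmbed n u c v)

/-- Number of distinct rows of the matrix `M_c^n`. -/
noncomputable def caRows {Q : Type*} (f : Q → Q → Q → Q) (n : ℕ) (c : Q) : ℕ :=
  Set.ncard {g : (Fin n → Q) → Q | ∃ u : Fin n → Q, g = fun v => caApply f n u c v}

/-- Number of distinct columns of the matrix `M_c^n`. -/
noncomputable def caCols {Q : Type*} (f : Q → Q → Q → Q) (n : ℕ) (c : Q) : ℕ :=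
  Set.ncard {g : (Fin n → Q) → Q | ∃ v : Fin n → Q, g = fun u => caApply f n u c v}

/-- `d_n(f)` for an ECA `f`. -/
noncomputable def dnECA (f : Bool → Bool → Bool → Bool) (n : ℕ) : ℕ :=
  max (max (caRows f n false) (caCols f n false)) (max (caRows f n true) (caCols f n true))

/-- The iterate `caIter f (n + 1)` also arises by applying the global map first. -/
lemma caIter_succ_comm {Q : Type*} (f : Q → Q → Q → Q) (n : ℕ) (x : ℤ → Q) :
    caIter f (n + 1) x = caIter f n fun i => f (x (i - 1)) (x i) (x (i + 1)) := by
  induction n generalizing x with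
  | zero => simp [caIter]
  | succ n ih =>
    rw [caIter, ih, ih, ih, caIter]
    simp only [sub_add_cancel, add_sub_cancel_right]

/-- If `x` alternates exactly on the interval `[-m, m]` (or at least there, when `m = n`), the
`n`-th iterate of negated majority is determined by `x 0`, `m` and `n`. -/
lemma caIter_not_majority_of_alternating (f : Bool → Bool → Bool → Bool)
    (hf : ∀ a b c : Bool, f a b c = !((a && b) || (b && c) || (a && c)))
    (n m : ℕ) (x : ℤ → Bool)
    (halt : ∀ j : ℤ, -m ≤ j → j < m → x (j + 1) = !x j)
    (hend : m = n ∨ x (m + 1) = x m ∨ x (-m - 1) = x (-m)) (hmn : m ≤ n) :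
    caIter f n x = xor (x 0) (m + n).bodd := by
  induction n generalizing m x with
  | zero =>
    obtain rfl : m = 0 := by omega
    simp [caIter]
  | succ n ih =>
    rw [caIter_succ_comm]
    rcases m with _ | m
    · have h : x 1 = x 0 ∨ x (-1) = x 0 := by simpa using hend
      rw [ih 0 _ (fun j _ _ => by simp at *; omega) _ (Nat.zero_le n)]
      · rcases h with h | h <;> cases h0 : x 0 <;> simp [hf, h, h0]
      · right
        rcases h with h | h
        · left
          cases h0 : x 0 <;> simp [hf, h, h0]
        · right
          cases h0 : x 0 <;> simp [hf, h, h0]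
    · have hy : ∀ j : ℤ, -m ≤ j → j ≤ m → f (x (j - 1)) (x j) (x (j + 1)) = x j := by
        intro j h1 h2
        have e1 := halt j (by push_cast; omega) (by push_cast; omega)
        have e2 := halt (j - 1) (by push_cast; omega) (by push_cast; omega)
        rw [sub_add_cancel] at e2
        rw [hf, e1, e2]
        cases x (j - 1) <;> rfl
      rw [ih m]
      · have h0 := hy 0 (by omega) (by omega)
        rw [h0]
        congr 1
        rw [show m + 1 + (n + 1) = m + n + 1 + 1 by ring, Nat.bodd_succ, Nat.bodd_succ,
          Bool.not_not]
      · intro j h1 h2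
        rw [hy j h1 (by omega), hy (j + 1) (by omega) (by omega)]
        exact halt j (by push_cast; omega) (by push_cast; omega)
      · rcases hend with h | h | h
        · left; omega
        · right; left
          have e := halt m (by push_cast; omega) (by push_cast; omega)
          push_cast at h
          rw [hy m (by omega) (by omega), hf, add_sub_cancel_right, h, e]
          cases x m <;> rfl
        · right; right
          have e := halt (-m - 1) (by push_cast; omega) (by push_cast; omega)
          rw [sub_add_cancel] at e
          have h' : x (-m - 1 - 1) = x (-m - 1) := by
            convert h using 2 <;> (push_cast; ring)
          rw [hy (-m) (by omega) (by omega), hf, sub_add_cancel, h', e]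
          cases x (-m - 1) <;> rfl
      · omega

/-- Length, truncated at `n`, of the maximal alternating initial run of `s`. -/
def alternatingDepth (n : ℕ) (s : ℕ → Bool) : ℕ :=
  Nat.find (p := fun k => k = n ∨ s (k + 1) = s k) ⟨n, Or.inl rfl⟩

lemma alternatingDepth_spec (n : ℕ) (s : ℕ → Bool) :
    alternatingDepth n s = n ∨ s (alternatingDepth n s + 1) = s (alternatingDepth n s) :=
  Nat.find_spec (p := fun k => k = n ∨ s (k + 1) = s k) ⟨n, Or.inl rfl⟩

lemma alternatingDepth_le (n : ℕ) (s : ℕ → Bool) : alternatingDepth n s ≤ n :=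
  Nat.find_min' _ (Or.inl rfl)

lemma eq_not_of_lt_alternatingDepth {n : ℕ} {s : ℕ → Bool} {j : ℕ}
    (hj : j < alternatingDepth n s) : s (j + 1) = !s j := by
  have h := Nat.find_min _ hj
  rw [not_or] at h
  exact Bool.eq_not.mpr h.2

lemma caIter_not_majority (f : Bool → Bool → Bool → Bool)
    (hf : ∀ a b c : Bool, f a b c = !((a && b) || (b && c) || (a && c)))
    (n : ℕ) (x : ℤ → Bool) :
    caIter f n x = xor (x 0) (min (alternatingDepth n fun j => x (-j))
      (alternatingDepth n fun j => x j) + n).bodd := by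
  set L := alternatingDepth n fun j => x (-j) with hL
  set R := alternatingDepth n fun j => x j with hR
  apply caIter_not_majority_of_alternating f hf
  · intro j h1 h2
    rcases lt_or_ge j 0 with hj | hj
    · obtain ⟨k, rfl⟩ : ∃ k : ℕ, j = -(k + 1 : ℕ) := ⟨(-j - 1).toNat, by omega⟩
      have h := eq_not_of_lt_alternatingDepth (n := n) (s := fun j => x (-j)) (j := k)
        (by omega)
      rw [h, Bool.not_not]
      congr 1
      push_cast
      ring
    · obtain ⟨k, rfl⟩ : ∃ k : ℕ, j = k := ⟨j.toNat, by omega⟩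
      have h := eq_not_of_lt_alternatingDepth (n := n) (s := fun j => x j) (j := k)
        (by omega)
      simpa using h
  · have h1 := alternatingDepth_spec n fun j => x (-j)
    have h2 := alternatingDepth_spec n fun j => x j
    have h3 := alternatingDepth_le n fun j => x (-j)
    have h4 := alternatingDepth_le n fun j => x j
    rw [← hL] at h1 h3
    rw [← hR] at h2 h4
    rcases le_total L R with h | h
    · rw [min_eq_left h]
      refine h1.imp_right fun e => Or.inr ?_
      rw [← e]
      congr 1
      push_cast
      ring
    · rw [min_eq_right h]
      refine h2.imp_right fun e => Or.inl ?_
      simpa using e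
  · exact (min_le_left _ _).trans (alternatingDepth_le _ _)

/-- The half-line configuration with `c` at `0`, followed by `v` and padded with `c`. -/
def halfLine (n : ℕ) (c : Bool) (v : Fin n → Bool) (j : ℕ) : Bool :=
  if h : 1 ≤ j ∧ j ≤ n then v ⟨j - 1, by omega⟩ else c

lemma caApply_not_majority (f : Bool → Bool → Bool → Bool)
    (hf : ∀ a b c : Bool, f a b c = !((a && b) || (b && c) || (a && c)))
    (n : ℕ) (u : Fin n → Bool) (c : Bool) (v : Fin n → Bool) :
    caApply f n u c v = xor c (min (alternatingDepth n (halfLine n c u))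
      (alternatingDepth n (halfLine n c v)) + n).bodd := by
  have hu : (fun j : ℕ => caEmbed n u c v (-j)) = halfLine n c u := by
    funext j
    simp only [caEmbed, halfLine]
    split_ifs <;> first | omega | rfl | skip
    congr 2
    omega
  have hv : (fun j : ℕ => caEmbed n u c v j) = halfLine n c v := by
    funext j
    simp only [caEmbed, halfLine]
    split_ifs <;> first | omega | rfl | skip
    congr 2
    omega
  rw [caApply, caIter_not_majority f hf, hu, hv]
  simp [caEmbed]

lemma exists_alternatingDepth_eq (n : ℕ) (c : Bool) {k : ℕ} (hk : k ≤ n) :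
    ∃ v : Fin n → Bool, alternatingDepth n (halfLine n c v) = k := by
  refine ⟨fun i => xor c (min (i.val + 1) k).bodd, ?_⟩
  have hs : ∀ j ≤ n, halfLine n c (fun i => xor c (min (i.val + 1) k).bodd) j =
      xor c (min j k).bodd := by
    intro j hj
    unfold halfLine
    split_ifs with h
    · simp only [Nat.sub_add_cancel h.1]
    · obtain rfl : j = 0 := by omega
      simp
  refine (Nat.find_eq_iff _).mpr ⟨?_, ?_⟩
  · rcases hk.eq_or_lt with rfl | h
    · exact Or.inl rfl
    · right
      rw [hs _ h, hs _ hk, min_eq_right (Nat.le_succ k), min_self]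
  · intro j hj
    rw [not_or, hs _ (by omega), hs _ (by omega), min_eq_left hj.le,
      min_eq_left (Nat.succ_le_of_lt hj), Nat.bodd_succ]
    exact ⟨by omega, by cases c <;> cases j.bodd <;> decide⟩

lemma caRows_not_majority (f : Bool → Bool → Bool → Bool)
    (hf : ∀ a b c : Bool, f a b c = !((a && b) || (b && c) || (a && c)))
    (n : ℕ) (c : Bool) : caRows f n c = n + 1 := by
  set g : ℕ → (Fin n → Bool) → Bool := fun k v =>
    xor c (min k (alternatingDepth n (halfLine n c v)) + n).bodd with hg
  have himage : {h : (Fin n → Bool) → Bool | ∃ u : Fin n → Bool,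
      h = fun v => caApply f n u c v} = g '' Set.Iic n := by
    ext h
    simp only [caApply_not_majority f hf, Set.mem_ofPred_eq, Set.mem_image, Set.mem_Iic]
    constructor
    · rintro ⟨u, rfl⟩
      exact ⟨_, alternatingDepth_le _ _, rfl⟩
    · rintro ⟨k, hk, rfl⟩
      obtain ⟨u, rfl⟩ := exists_alternatingDepth_eq n c hk
      exact ⟨u, rfl⟩
  have hne : ∀ k l : ℕ, k < l → l ≤ n → g k ≠ g l := by
    intro k l hkl hl h
    obtain ⟨v, hv⟩ := exists_alternatingDepth_eq n c (k := k + 1) (by omega)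
    have e := congrFun h v
    simp only [hg, hv, min_eq_left (Nat.le_succ k), min_eq_right (Nat.succ_le_of_lt hkl)] at e
    rw [show k + 1 + n = k + n + 1 by ring, Nat.bodd_succ] at e
    revert e
    cases c <;> cases (k + n).bodd <;> decide
  have hinj : Set.InjOn g (Set.Iic n) := by
    intro k hk l hl h
    by_contra hkl
    rcases lt_or_gt_of_ne hkl with hlt | hlt
    · exact hne k l hlt hl h
    · exact hne l k hlt hk h.symm
  rw [caRows, himage, hinj.ncard_image, ← Finset.coe_Iic, Set.ncard_coe_finset,
    Nat.card_Iic]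

lemma caCols_not_majority (f : Bool → Bool → Bool → Bool)
    (hf : ∀ a b c : Bool, f a b c = !((a && b) || (b && c) || (a && c)))
    (n : ℕ) (c : Bool) : caCols f n c = n + 1 := by
  rw [← caRows_not_majority f hf n c]
  simp only [caCols, caRows, caApply_not_majority f hf, min_comm]

/-- For rule 23, `f(a,b,c) = ¬((a && b) || (b && c) || (a && c))` (negation of the
majority), we have `d_n(f) = n + 1` for all `n ≥ 1`. -/
theorem rule23_dn (f : Bool → Bool → Bool → Bool)
    (hf : ∀ a b c : Bool, f a b c = !((a && b) || (b && c) || (a && c))) :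
    ∀ n : ℕ, 1 ≤ n → dnECA f n = n + 1 := by
  intro n _
  simp only [dnECA, caRows_not_majority f hf, caCols_not_majority f hf, max_self]
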